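/- arXiv:2007.05420 — 4 statements merged into one kernel-verified Lean document; each statement's English description precedes it below -/
import Mathlib

section
/- The algebra H∞(𝔻×ℕ) is Hermite: for every n ≥ 1 and every unimodular row (f₁,…,fₙ) ∈ H∞(𝔻×ℕ)ⁿ (i.e., there exist u₁,…,uₙ ∈ H∞(𝔻×ℕ) with u₁f₁ + ⋯ + uₙfₙ = 1), there exists an n×n matrix with entries in H∞(𝔻×ℕ) whose first row is (f₁,…,fₙ) and which is invertible over H∞(𝔻×ℕ) (its inverse matrix also has entries in H∞(𝔻×ℕ)). -/
/-- Membership in `H^∞(𝔻 × ℕ)`: a function on the countable disjoint union of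
unit disks whose every slice `z ↦ f z n` is holomorphic on `𝔻 = {z : |z| < 1}`
and which is uniformly bounded. -/
def MemHinfN (f : ℂ → ℕ → ℂ) : Prop :=
  (∀ n : ℕ, DifferentiableOn ℂ (fun z => f z n) (Metric.ball 0 1)) ∧
    ∃ M : ℝ, ∀ z ∈ Metric.ball (0 : ℂ) 1, ∀ n : ℕ, ‖f z n‖ ≤ M

open scoped ComplexInnerProductSpace ComplexConjugate

section Hardy

variable {E : Type*} [NormedAddCommGroup E]

/-- The Hardy space `H²(E)` of the disk, as square-summable sequences of Taylor coefficients. -/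
abbrev HardyTwo (E : Type*) [NormedAddCommGroup E] : Type _ := lp (fun _ : ℕ => E) 2

namespace HardyTwo

lemma memlp_two_iff {a : ℕ → E} : Memℓp a 2 ↔ Summable fun k => ‖a k‖ ^ 2 := by
  rw [memℓp_gen_iff (by norm_num)]
  simp

lemma norm_sq_eq_tsum (h : HardyTwo E) : ‖h‖ ^ 2 = ∑' k, ‖h k‖ ^ 2 := by
  have := lp.norm_rpow_eq_tsum (p := 2) (by norm_num) h
  simpa using this

/-- The element of the Hardy space with given square-summable Taylor coefficients. -/
def mk (a : ℕ → E) (ha : Summable fun k => ‖a k‖ ^ 2) : HardyTwo E := ⟨a, memlp_two_iff.2 ha⟩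

lemma mk_apply (a : ℕ → E) (ha : Summable fun k => ‖a k‖ ^ 2) (k : ℕ) : mk a ha k = a k := rfl

/-- The sequence `a` with a zero prepended. -/
def shiftSeq (a : ℕ → E) : ℕ → E
  | 0 => 0
  | k + 1 => a k

lemma hasSum_norm_shiftSeq (h : HardyTwo E) :
    HasSum (fun k => ‖shiftSeq h k‖ ^ 2) (‖h‖ ^ 2) := by
  have hs : HasSum (fun k => ‖h k‖ ^ 2) (‖h‖ ^ 2) := by
    rw [norm_sq_eq_tsum]
    exact (memlp_two_iff.1 (lp.memℓp h)).hasSum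
  rw [← hasSum_nat_add_iff' 1]
  simpa [shiftSeq] using hs

lemma norm_sq_lt_one {z : ℂ} (hz : ‖z‖ < 1) : ‖z‖ ^ 2 < 1 := by
  have := norm_nonneg z
  nlinarith

variable [InnerProductSpace ℂ E]

lemma hasSum_norm_kernel {z : ℂ} (hz : ‖z‖ < 1) (v : E) :
    HasSum (fun k : ℕ => ‖conj z ^ k • v‖ ^ 2) (‖v‖ ^ 2 / (1 - ‖z‖ ^ 2)) := by
  have h := (hasSum_geometric_of_lt_one (sq_nonneg ‖z‖) (norm_sq_lt_one hz)).mul_left (‖v‖ ^ 2)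
  rw [div_eq_mul_inv]
  refine h.congr_fun fun k => ?_
  rw [norm_smul, norm_pow, RCLike.norm_conj]
  ring

open Classical in
/-- The Szegő kernel: `⟪kernel z v, h⟫ = ⟪v, h(z)⟫` for `z` in the disk. -/
noncomputable def kernel (z : ℂ) : E →ₗ[ℂ] HardyTwo E where
  toFun v := if hz : ‖z‖ < 1 then
    ⟨fun k => conj z ^ k • v, memlp_two_iff.2 (hasSum_norm_kernel hz v).summable⟩ else 0
  map_add' v w := by
    split_ifs
    · ext k; exact smul_add _ _ _
    · simp
  map_smul' c v := by
    split_ifs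
    · ext k; simp [smul_comm c]
    · simp

lemma kernel_apply {z : ℂ} (hz : ‖z‖ < 1) (v : E) (k : ℕ) :
    kernel z v k = conj z ^ k • v := by
  simp [kernel, hz]

lemma norm_sq_kernel {z : ℂ} (hz : ‖z‖ < 1) (v : E) :
    ‖kernel z v‖ ^ 2 = ‖v‖ ^ 2 / (1 - ‖z‖ ^ 2) := by
  rw [norm_sq_eq_tsum, ← (hasSum_norm_kernel hz v).tsum_eq]
  simp_rw [kernel_apply hz]

lemma hasSum_inner_kernel {z : ℂ} (hz : ‖z‖ < 1) (v : E) (h : HardyTwo E) :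
    HasSum (fun k => z ^ k * ⟪v, h k⟫) ⟪kernel z v, h⟫ := by
  have := lp.hasSum_inner (𝕜 := ℂ) (kernel z v) h
  simpa [kernel_apply hz, inner_smul_left] using this

lemma inner_kernel_zero (v : E) (h : HardyTwo E) : ⟪kernel 0 v, h⟫ = ⟪v, h 0⟫ := by
  refine (hasSum_inner_kernel (by simp) v h).unique ?_
  convert hasSum_ite_eq (0 : ℕ) ⟪v, h 0⟫ using 2 with k
  by_cases hk : k = 0 <;> simp [hk]

lemma differentiableOn_inner_kernel (v : E) (h : HardyTwo E) :
    DifferentiableOn ℂ (fun z => ⟪kernel z v, h⟫) (Metric.ball 0 1) := by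
  intro z hz
  rw [mem_ball_zero_iff] at hz
  obtain ⟨r, hzr, hr⟩ := exists_between hz
  have hr0 : 0 ≤ r := (norm_nonneg z).trans hzr.le
  have key : DifferentiableOn ℂ (fun w => ∑' k, w ^ k * ⟪v, h k⟫) (Metric.ball 0 r) := by
    refine Complex.differentiableOn_tsum_of_summable_norm (u := fun k => r ^ k * (‖v‖ * ‖h‖))
      ((summable_geometric_of_lt_one hr0 hr).mul_right _) (fun k => by fun_prop)
      Metric.isOpen_ball fun k w hw => ?_
    rw [mem_ball_zero_iff] at hw
    rw [norm_mul, norm_pow]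
    gcongr
    exact (norm_inner_le_norm _ _).trans (by gcongr; exact lp.norm_apply_le_norm (by simp) h k)
  have hnhds : Metric.ball (0 : ℂ) r ∈ nhds z := Metric.isOpen_ball.mem_nhds (by simpa using hzr)
  refine ((key.differentiableAt hnhds).congr_of_eventuallyEq ?_).differentiableWithinAt
  filter_upwards [hnhds] with w hw
  rw [mem_ball_zero_iff] at hw
  exact (hasSum_inner_kernel (hw.trans hr) v h).tsum_eq.symm

/-- The forward shift on `H²(E)`, i.e. multiplication by the coordinate function. -/
noncomputable def shift : HardyTwo E →ₗᵢ[ℂ] HardyTwo E where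
  toFun h := ⟨shiftSeq h, memlp_two_iff.2 (hasSum_norm_shiftSeq h).summable⟩
  map_add' h₁ h₂ := by
    ext (_ | k)
    · exact (add_zero (0 : E)).symm
    · rfl
  map_smul' c h := by
    ext (_ | k)
    · exact (smul_zero c).symm
    · rfl
  norm_map' h := by
    rw [← sq_eq_sq₀ (norm_nonneg _) (norm_nonneg _), norm_sq_eq_tsum]
    exact (hasSum_norm_shiftSeq h).tsum_eq

lemma shift_zero (h : HardyTwo E) : shift h 0 = 0 := rfl

lemma shift_succ (h : HardyTwo E) (k : ℕ) : shift h (k + 1) = h k := rfl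

lemma inner_kernel_shift {z : ℂ} (hz : ‖z‖ < 1) (v : E) (h : HardyTwo E) :
    ⟪kernel z v, shift h⟫ = z * ⟪kernel z v, h⟫ := by
  refine (hasSum_inner_kernel hz v _).unique ?_
  rw [← hasSum_nat_add_iff' 1]
  simpa [shift_zero, shift_succ, pow_succ', mul_assoc] using
    (hasSum_inner_kernel hz v h).mul_left z

lemma exists_shift_eq {h : HardyTwo E} (h0 : h 0 = 0) : ∃ h', shift h' = h := by
  refine ⟨⟨fun k => h (k + 1), memlp_two_iff.2 ?_⟩, ?_⟩
  · exact (summable_nat_add_iff 1).2 (memlp_two_iff.1 (lp.memℓp h))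
  · ext (_ | k)
    · rw [shift_zero, h0]
    · rfl

end HardyTwo

end Hardy

section Parseval

open AddCircle MeasureTheory

/-- Parseval's identity for absolutely convergent Fourier series with nonnegative frequencies. -/
lemma norm_sq_toLp_tsum_fourier {a : ℕ → ℂ} (ha : Summable fun k => ‖a k‖) :
    ‖ContinuousMap.toLp (E := ℂ) 2 (haarAddCircle (T := 1)) ℂ
      (∑' k : ℕ, a k • fourier (T := 1) (k : ℤ))‖ ^ 2 = ∑' k, ‖a k‖ ^ 2 := by
  have hs : Summable fun k : ℕ => a k • fourier (T := 1) (k : ℤ) :=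
    Summable.of_norm (by simpa [norm_smul, fourier_norm] using ha)
  have h1 := hs.hasSum.mapL (ContinuousMap.toLp (E := ℂ) 2 (haarAddCircle (T := 1)) ℂ)
  have ho : Orthonormal ℂ fun k : ℕ => fourierLp (T := 1) 2 (k : ℤ) :=
    orthonormal_fourier.comp _ Nat.cast_injective
  set g := ContinuousMap.toLp (E := ℂ) 2 (haarAddCircle (T := 1)) ℂ
      (∑' k : ℕ, a k • fourier (T := 1) (k : ℤ))
  have h2 : ∀ k : ℕ, ⟪fourierLp (T := 1) 2 (k : ℤ), g⟫ = a k := by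
    intro k
    refine (h1.mapL (innerSL ℂ (fourierLp (T := 1) 2 (k : ℤ)))).unique ?_
    refine (hasSum_ite_eq k (a k)).congr_fun fun j => ?_
    rw [innerSL_apply_apply, map_smul, inner_smul_right, orthonormal_iff_ite.1 ho k j]
    by_cases hjk : j = k
    · simp [hjk]
    · simp [hjk, Ne.symm hjk]
  have h3 := h1.mapL (innerSL ℂ g)
  have h4 : HasSum (fun k => ((‖a k‖ ^ 2 : ℝ) : ℂ)) ((‖g‖ ^ 2 : ℝ) : ℂ) := by
    have hg : ((‖g‖ ^ 2 : ℝ) : ℂ) = innerSL ℂ g g := by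
      rw [innerSL_apply_apply, inner_self_eq_norm_sq_to_K]
      simp
    rw [hg]
    refine h3.congr_fun fun k => ?_
    rw [innerSL_apply_apply, map_smul, inner_smul_right, ← inner_conj_symm, h2, Complex.mul_conj']
    simp
  exact (Complex.hasSum_ofReal.1 h4).tsum_eq.symm

lemma hasSum_fourier_apply {a : ℕ → ℂ} (ha : Summable fun k => ‖a k‖) (x : AddCircle (1 : ℝ)) :
    HasSum (fun k => a k * fourier (1 : ℤ) x ^ k)
      ((∑' k : ℕ, a k • fourier (T := 1) (k : ℤ)) x) := by
  have hs : Summable fun k : ℕ => a k • fourier (T := 1) (k : ℤ) :=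
    Summable.of_norm (by simpa [norm_smul, fourier_norm] using ha)
  have := hs.hasSum.mapL (ContinuousMap.evalCLM ℂ x)
  refine this.congr_fun fun k => ?_
  simp [fourier_apply, AddCircle.toCircle_nsmul]

lemma tsum_norm_sq_le_of_norm_tsum_le {a b : ℕ → ℂ} (ha : Summable fun k => ‖a k‖)
    (hb : Summable fun k => ‖b k‖) {C : ℝ}
    (hab : ∀ ζ : ℂ, ‖ζ‖ = 1 → ‖∑' k, a k * ζ ^ k‖ ≤ C * ‖∑' k, b k * ζ ^ k‖) :
    ∑' k, ‖a k‖ ^ 2 ≤ C ^ 2 * ∑' k, ‖b k‖ ^ 2 := by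
  rw [← norm_sq_toLp_tsum_fourier ha, ← norm_sq_toLp_tsum_fourier hb, ← mul_pow]
  gcongr
  refine Lp.norm_le_mul_norm_of_ae_le_mul ?_
  filter_upwards [ContinuousMap.coeFn_toLp (p := 2) (𝕜 := ℂ) (haarAddCircle (T := 1))
      (∑' k : ℕ, a k • fourier (T := 1) (k : ℤ)),
    ContinuousMap.coeFn_toLp (p := 2) (𝕜 := ℂ) (haarAddCircle (T := 1))
      (∑' k : ℕ, b k • fourier (T := 1) (k : ℤ))] with x hx hy
  rw [hx, hy, ← (hasSum_fourier_apply ha x).tsum_eq, ← (hasSum_fourier_apply hb x).tsum_eq]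
  exact hab _ (by rw [fourier_apply]; exact Circle.norm_coe _)

end Parseval

section Multiplier

open Metric

lemma exists_taylor_mul_geometric {g : ℂ → ℂ} (hg : DifferentiableOn ℂ g (ball 0 1)) {C : ℝ}
    (hC : ∀ w ∈ ball (0 : ℂ) 1, ‖g w‖ ≤ C) {z : ℂ} (hz : ‖z‖ < 1) :
    ∃ c : ℕ → ℂ, (∀ w ∈ ball (0 : ℂ) 1,
        HasSum (fun k => w ^ k * c k) (g w * (1 - conj z * w)⁻¹)) ∧
      (Summable fun k => ‖c k‖ ^ 2) ∧ ∑' k, ‖c k‖ ^ 2 ≤ C ^ 2 / (1 - ‖z‖ ^ 2) := by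
  have hC0 : 0 ≤ C := (norm_nonneg _).trans (hC 0 (by simp))
  have hzw : ∀ w ∈ ball (0 : ℂ) 1, ‖conj z * w‖ < 1 := fun w hw => by
    rw [mem_ball_zero_iff] at hw
    rw [norm_mul, RCLike.norm_conj]
    exact mul_lt_one_of_nonneg_of_lt_one_left (norm_nonneg _) hz hw.le
  have hG : DifferentiableOn ℂ (fun w => g w * (1 - conj z * w)⁻¹) (ball 0 1) := by
    refine hg.mul (DifferentiableOn.inv (by fun_prop) fun w hw h0 => ?_)
    have := hzw w hw
    rw [← sub_eq_zero.1 h0] at this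
    simp at this
  set c : ℕ → ℂ := fun k =>
    (k.factorial : ℂ)⁻¹ * iteratedDeriv k (fun w => g w * (1 - conj z * w)⁻¹) 0 with hc
  have hsum : ∀ w ∈ ball (0 : ℂ) 1, HasSum (fun k => w ^ k * c k) (g w * (1 - conj z * w)⁻¹) := by
    intro w hw
    refine (Complex.hasSum_taylorSeries_on_ball (c := 0) (r := 1) hG hw).congr_fun fun k => ?_
    simp only [hc, smul_eq_mul, sub_zero]
    ring
  have hbound : ∀ r ∈ Set.Ioo (0 : ℝ) 1, ∑' k, ‖(r : ℂ) ^ k * c k‖ ^ 2 ≤ C ^ 2 / (1 - ‖z‖ ^ 2) ∧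
      Summable fun k => ‖(r : ℂ) ^ k * c k‖ ^ 2 := by
    intro r hr
    have hrb : ∀ ζ : ℂ, ‖ζ‖ = 1 → (r : ℂ) * ζ ∈ ball (0 : ℂ) 1 := fun ζ hζ => by
      rw [mem_ball_zero_iff, norm_mul, hζ, mul_one, Complex.norm_of_nonneg hr.1.le]
      exact hr.2
    have ha : Summable fun k => ‖(r : ℂ) ^ k * c k‖ :=
      (hsum r (by simpa using hrb 1 (by simp))).summable.norm
    have hb : Summable fun k => ‖(conj z * r) ^ k‖ :=
      (summable_geometric_of_norm_lt_one (hzw r (by simpa using hrb 1 (by simp)))).norm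
    have ha2 : Summable fun k => ‖(r : ℂ) ^ k * c k‖ ^ 2 := by
      refine HardyTwo.memlp_two_iff.1 (Memℓp.of_exponent_ge (q := 1) ?_ one_le_two)
      exact memℓp_gen (by simpa using ha)
    have key := tsum_norm_sq_le_of_norm_tsum_le ha hb fun ζ hζ => by
      have h1 : ∑' k, (r : ℂ) ^ k * c k * ζ ^ k = _ :=
        ((hsum _ (hrb ζ hζ)).congr_fun fun k => by ring).tsum_eq
      have h2 : ∑' k, (conj z * r) ^ k * ζ ^ k = _ :=
        ((hasSum_geometric_of_norm_lt_one (hzw _ (hrb ζ hζ))).congr_fun fun k => by ring).tsum_eq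
      rw [h1, h2, norm_mul]
      gcongr
      exact hC _ (hrb ζ hζ)
    refine ⟨key.trans ?_, ha2⟩
    rw [div_eq_mul_inv]
    gcongr
    have hgeom := hasSum_geometric_of_lt_one (sq_nonneg ‖z‖) (HardyTwo.norm_sq_lt_one hz)
    rw [← hgeom.tsum_eq]
    have hle : ∀ k, ‖(conj z * r) ^ k‖ ^ 2 ≤ (‖z‖ ^ 2) ^ k := fun k => by
      rw [norm_pow, norm_mul, RCLike.norm_conj, Complex.norm_of_nonneg hr.1.le, ← pow_mul,
        ← pow_mul, mul_comm k]
      gcongr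
      · exact mul_nonneg (norm_nonneg _) hr.1.le
      · exact mul_le_of_le_one_right (norm_nonneg _) hr.2.le
    exact (Summable.of_nonneg_of_le (fun _ => by positivity) hle hgeom.summable).tsum_le_tsum hle
      hgeom.summable
  have hfin : ∀ s : Finset ℕ, ∑ k ∈ s, ‖c k‖ ^ 2 ≤ C ^ 2 / (1 - ‖z‖ ^ 2) := by
    intro s
    have hcont : Filter.Tendsto (fun r : ℝ => ∑ k ∈ s, ‖(r : ℂ) ^ k * c k‖ ^ 2)
        (nhdsWithin 1 (Set.Iio 1)) (nhds (∑ k ∈ s, ‖((1 : ℝ) : ℂ) ^ k * c k‖ ^ 2)) :=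
      Continuous.continuousWithinAt (by fun_prop)
    simp only [Complex.ofReal_one, one_pow, one_mul] at hcont
    refine le_of_tendsto hcont ?_
    filter_upwards [Ioo_mem_nhdsLT zero_lt_one] with r hr
    exact ((hbound r hr).2.sum_le_tsum s fun _ _ => by positivity).trans (hbound r hr).1
  have hs : Summable fun k => ‖c k‖ ^ 2 := summable_of_sum_le (fun _ => by positivity) hfin
  exact ⟨c, hsum, hs, hs.tsum_le_of_sum_le hfin⟩

/-- Multiplying a Szegő kernel by a bounded holomorphic vector-valued function gives an element
of the Hardy space whose norm is controlled by the sup norm. -/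
lemma exists_hardyTwo_mul_kernel {ι : Type*} [Fintype ι] {g : ι → ℂ → ℂ}
    (hg : ∀ i, DifferentiableOn ℂ (g i) (ball 0 1)) {C : ℝ}
    (hC : ∀ i, ∀ w ∈ ball (0 : ℂ) 1, ‖g i w‖ ≤ C) {z : ℂ} (hz : ‖z‖ < 1) :
    ∃ h : HardyTwo (EuclideanSpace ℂ ι),
      (∀ w ∈ ball (0 : ℂ) 1, ∀ v, ⟪HardyTwo.kernel w v, h⟫ =
        (∑ i, g i w * conj (v i)) * (1 - conj z * w)⁻¹) ∧
      ‖h‖ ^ 2 ≤ Fintype.card ι * (C ^ 2 / (1 - ‖z‖ ^ 2)) := by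
  choose c hc hs hle using fun i => exists_taylor_mul_geometric (hg i) (hC i) hz
  have hnorm : ∀ k, ‖WithLp.toLp 2 fun i => c i k‖ ^ 2 = ∑ i, ‖c i k‖ ^ 2 := fun k => by
    rw [EuclideanSpace.norm_sq_eq]
  refine ⟨HardyTwo.mk (fun k => WithLp.toLp 2 fun i => c i k) ?_, ?_, ?_⟩
  · simp_rw [hnorm]
    exact summable_sum fun i _ => hs i
  · intro w hw v
    refine (HardyTwo.hasSum_inner_kernel (by simpa using hw) v _).unique ?_
    have hsum := hasSum_sum (s := Finset.univ) fun i _ =>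
      (hc i w hw).mul_left ((starRingEnd ℂ) (v i))
    rw [show (∑ i, g i w * conj (v i)) * (1 - conj z * w)⁻¹ =
        ∑ i, (starRingEnd ℂ) (v i) * (g i w * (1 - conj z * w)⁻¹) by
      rw [Finset.sum_mul]
      exact Finset.sum_congr rfl fun i _ => by ring]
    refine hsum.congr_fun fun k => ?_
    rw [HardyTwo.mk_apply, PiLp.inner_apply, Finset.mul_sum]
    refine Finset.sum_congr rfl fun i _ => ?_
    rw [RCLike.inner_apply]
    ring
  · rw [HardyTwo.norm_sq_eq_tsum]
    simp_rw [HardyTwo.mk_apply, hnorm]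
    rw [Summable.tsum_finsetSum fun i _ => hs i]
    exact (Finset.sum_le_card_nsmul _ _ _ fun i _ => hle i).trans (by simp)

end Multiplier

section WanderingSubspace

variable {H : Type*} [NormedAddCommGroup H] [InnerProductSpace ℂ H]

/-- If `k` is an eigenvector of the adjoint of an isometry `S` relative to an invariant subspace
`N`, then its projection onto the wandering subspace `N ⊖ S N` has a norm determined by the norm
of its projection onto `N`. -/
lemma norm_sq_starProjection_wandering {S : H →ₗᵢ[ℂ] H} {N W : Submodule ℂ H}
    [N.HasOrthogonalProjection] [W.HasOrthogonalProjection]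
    (hW : W = N ⊓ (N.map S.toLinearMap)ᗮ) (hN : ∀ h ∈ N, S h ∈ N) {k : H} {z : ℂ}
    (hk : ∀ h ∈ N, ⟪k, S h⟫ = z * ⟪k, h⟫) :
    ‖W.starProjection k‖ ^ 2 =
      (1 - ‖z‖ ^ 2) * ‖N.starProjection k‖ ^ 2 := by
  set q := N.starProjection k with hq
  have hqN : q ∈ N := N.starProjection_apply_mem k
  have hqi : ∀ h ∈ N, ⟪q, h⟫ = ⟪k, h⟫ := fun h hh => by
    have := Submodule.starProjection_inner_eq_zero k h hh
    rw [inner_sub_left, sub_eq_zero] at this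
    exact this.symm
  have hqS : ∀ h ∈ N, ⟪q, S h⟫ = z * ⟪q, h⟫ := fun h hh => by
    rw [hqi _ (hN h hh), hqi h hh, hk h hh]
  have hw : W.starProjection k = q - conj z • S q := by
    subst hW
    refine Submodule.eq_starProjection_of_mem_of_inner_eq_zero
      ⟨N.sub_mem hqN (N.smul_mem _ (hN q hqN)), ?_⟩ ?_
    · rw [SetLike.mem_coe, Submodule.mem_orthogonal']
      rintro _ ⟨h, hh, rfl⟩
      change ⟪q - conj z • S q, S h⟫ = 0
      rw [inner_sub_left, inner_smul_left, hqS h hh, S.inner_map_map]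
      simp
    · rintro y ⟨hyN, hyS⟩
      rw [SetLike.mem_coe, Submodule.mem_orthogonal] at hyS
      have : ⟪S q, y⟫ = 0 := hyS _ ⟨q, hqN, rfl⟩
      rw [← sub_add, inner_add_left, inner_sub_left, hqi y hyN, inner_smul_left, this]
      simp
  rw [hw]
  have hre : ⟪q, conj z • S q⟫ = ((‖z‖ ^ 2 * ‖q‖ ^ 2 : ℝ) : ℂ) := by
    rw [inner_smul_right, hqS q hqN, inner_self_eq_norm_sq_to_K, ← mul_assoc, Complex.conj_mul']
    simp
  rw [norm_sub_sq (𝕜 := ℂ), hre, norm_smul, RCLike.norm_conj, S.norm_map, RCLike.re_to_complex,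
    Complex.ofReal_re]
  ring

end WanderingSubspace

section KernelOfRow

open Metric HardyTwo

variable {ι : Type*} [Fintype ι]

/-- The vector representing evaluation of the linear form `v ↦ ∑ i, f i z * v i`. -/
noncomputable def conjRow (f : ι → ℂ → ℂ) (z : ℂ) : EuclideanSpace ℂ ι :=
  WithLp.toLp 2 fun i => conj (f i z)

lemma inner_conjRow (f : ι → ℂ → ℂ) (z : ℂ) (v : EuclideanSpace ℂ ι) :
    ⟪conjRow f z, v⟫ = ∑ i, f i z * v i := by
  rw [PiLp.inner_apply]
  refine Finset.sum_congr rfl fun i _ => ?_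
  rw [RCLike.inner_apply, mul_comm]
  simp [conjRow]

/-- The subspace of all `h` in the Hardy space with `∑ i, f i * h i = 0` on the disk. -/
noncomputable def rowKernel (f : ι → ℂ → ℂ) : Submodule ℂ (HardyTwo (EuclideanSpace ℂ ι)) :=
  (Submodule.span ℂ ((fun z => kernel z (conjRow f z)) '' ball 0 1))ᗮ

lemma mem_rowKernel {f : ι → ℂ → ℂ} {h : HardyTwo (EuclideanSpace ℂ ι)} :
    h ∈ rowKernel f ↔ ∀ z ∈ ball (0 : ℂ) 1, ⟪kernel z (conjRow f z), h⟫ = 0 := by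
  constructor
  · intro hh z hz
    exact (Submodule.mem_orthogonal _ _).1 hh _ (Submodule.subset_span ⟨z, hz, rfl⟩)
  · intro hh
    refine (Submodule.mem_orthogonal _ _).2 fun x hx => ?_
    induction hx using Submodule.span_induction with
    | mem x hx => obtain ⟨z, hz, rfl⟩ := hx; exact hh z hz
    | zero => simp
    | add x y _ _ hx hy => rw [inner_add_left, hx, hy, add_zero]
    | smul c x _ hx => rw [inner_smul_left, hx, mul_zero]

instance (f : ι → ℂ → ℂ) : (rowKernel f).HasOrthogonalProjection := by
  unfold rowKernel; infer_instance

/-- The wandering subspace of the shift restricted to `rowKernel f`. -/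
noncomputable def rowWandering (f : ι → ℂ → ℂ) : Submodule ℂ (HardyTwo (EuclideanSpace ℂ ι)) :=
  rowKernel f ⊓ ((rowKernel f).map (shift (E := EuclideanSpace ℂ ι)).toLinearMap)ᗮ

lemma shift_mem_rowKernel {f : ι → ℂ → ℂ} {h : HardyTwo (EuclideanSpace ℂ ι)}
    (hh : h ∈ rowKernel f) : shift h ∈ rowKernel f := by
  rw [mem_rowKernel] at hh ⊢
  intro z hz
  rw [inner_kernel_shift (by simpa using hz), hh z hz, mul_zero]

lemma kernel_eq_sum [DecidableEq ι] (z : ℂ) (v : EuclideanSpace ℂ ι) :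
    kernel z v = ∑ i, v i • kernel z (EuclideanSpace.single i (1 : ℂ)) := by
  conv_lhs => rw [← (EuclideanSpace.basisFun ι ℂ).sum_repr v]
  simp

lemma inner_kernel_eq_sum [DecidableEq ι] (z : ℂ) (v : EuclideanSpace ℂ ι)
    (h : HardyTwo (EuclideanSpace ℂ ι)) :
    ⟪kernel z v, h⟫ = ∑ i, conj (v i) * ⟪kernel z (EuclideanSpace.single i (1 : ℂ)), h⟫ := by
  simp [kernel_eq_sum z v, mul_comm]

lemma mem_rowKernel_of_shift_mem {f : ι → ℂ → ℂ}
    (hf : ∀ i, DifferentiableOn ℂ (f i) (ball 0 1)) {h : HardyTwo (EuclideanSpace ℂ ι)}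
    (hh : shift h ∈ rowKernel f) : h ∈ rowKernel f := by
  classical
  rw [mem_rowKernel] at hh ⊢
  have hne : ∀ z ∈ ball (0 : ℂ) 1, z ≠ 0 → ⟪kernel z (conjRow f z), h⟫ = 0 := fun z hz h0 => by
    have := hh z hz
    rw [inner_kernel_shift (by simpa using hz)] at this
    exact (mul_eq_zero.1 this).resolve_left h0
  have hcont : ContinuousOn (fun z => ⟪kernel z (conjRow f z), h⟫) (ball 0 1) := by
    simp_rw [inner_kernel_eq_sum _ (conjRow f _), conjRow, Complex.conj_conj]
    exact continuousOn_finsetSum _ fun i _ =>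
      (hf i).continuousOn.mul (differentiableOn_inner_kernel _ h).continuousOn
  intro z hz
  by_cases h0 : z = 0
  · subst h0
    have h1 : Filter.Tendsto (fun z => ⟪kernel z (conjRow f z), h⟫) (nhdsWithin 0 {0}ᶜ)
        (nhds ⟪kernel 0 (conjRow f 0), h⟫) :=
      (hcont.continuousAt (isOpen_ball.mem_nhds hz)).tendsto.mono_left nhdsWithin_le_nhds
    refine tendsto_nhds_unique h1 (tendsto_const_nhds.congr' ?_)
    filter_upwards [nhdsWithin_le_nhds (isOpen_ball.mem_nhds hz), self_mem_nhdsWithin] with w hw hw0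
    exact (hne w hw hw0).symm
  · exact hne z hz h0

lemma injective_eval_zero {f : ι → ℂ → ℂ}
    (hf : ∀ i, DifferentiableOn ℂ (f i) (ball 0 1)) {h : HardyTwo (EuclideanSpace ℂ ι)}
    (hh : h ∈ rowWandering f) (h0 : h 0 = 0) : h = 0 := by
  obtain ⟨h', rfl⟩ := exists_shift_eq h0
  have := (Submodule.mem_orthogonal _ _).1 hh.2 (shift h')
    ⟨h', mem_rowKernel_of_shift_mem hf hh.1, rfl⟩
  exact inner_self_eq_zero.1 this

/-- Evaluation at the origin as a map from the wandering subspace to the kernel of `f 0`. -/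
noncomputable def wanderingEval (f : ι → ℂ → ℂ) :
    rowWandering f →ₗ[ℂ] (ℂ ∙ conjRow f 0)ᗮ where
  toFun h := ⟨(h : HardyTwo (EuclideanSpace ℂ ι)) 0, by
    rw [Submodule.mem_orthogonal_singleton_iff_inner_right, ← inner_kernel_zero]
    exact mem_rowKernel.1 h.2.1 0 (by simp)⟩
  map_add' _ _ := rfl
  map_smul' _ _ := rfl

lemma wanderingEval_injective {f : ι → ℂ → ℂ}
    (hf : ∀ i, DifferentiableOn ℂ (f i) (ball 0 1)) : Function.Injective (wanderingEval f) := by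
  rw [injective_iff_map_eq_zero]
  intro h hh
  exact Subtype.ext (injective_eval_zero hf h.2 (congrArg Subtype.val hh))

lemma finiteDimensional_rowWandering {f : ι → ℂ → ℂ}
    (hf : ∀ i, DifferentiableOn ℂ (f i) (ball 0 1)) : FiniteDimensional ℂ (rowWandering f) :=
  FiniteDimensional.of_injective _ (wanderingEval_injective hf)

lemma norm_sq_starProjection_rowWandering (f : ι → ℂ → ℂ)
    [(rowWandering f).HasOrthogonalProjection] {z : ℂ} (hz : ‖z‖ < 1) (v : EuclideanSpace ℂ ι) :
    ‖(rowWandering f).starProjection (kernel z v)‖ ^ 2 =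
      (1 - ‖z‖ ^ 2) * ‖(rowKernel f).starProjection (kernel z v)‖ ^ 2 := by
  exact norm_sq_starProjection_wandering (N := rowKernel f) (W := rowWandering f) rfl
    (fun h hh => shift_mem_rowKernel hh) fun h _ => inner_kernel_shift hz v h

lemma norm_starProjection_rowWandering_le (f : ι → ℂ → ℂ)
    [(rowWandering f).HasOrthogonalProjection] {z : ℂ} (hz : ‖z‖ < 1) (v : EuclideanSpace ℂ ι) :
    ‖(rowWandering f).starProjection (kernel z v)‖ ≤ ‖v‖ := by
  have hz' := sub_pos.2 (norm_sq_lt_one hz)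
  rw [← sq_le_sq₀ (norm_nonneg _) (norm_nonneg _), norm_sq_starProjection_rowWandering f hz,
    ← le_div_iff₀' hz', ← norm_sq_kernel hz]
  gcongr
  exact (rowKernel f).norm_starProjection_apply_le _

lemma exists_mem_rowKernel {f u : ι → ℂ → ℂ}
    (hf : ∀ i, DifferentiableOn ℂ (f i) (ball 0 1))
    (hu : ∀ i, DifferentiableOn ℂ (u i) (ball 0 1)) {C : ℝ}
    (hfC : ∀ i, ∀ w ∈ ball (0 : ℂ) 1, ‖f i w‖ ≤ C) (huC : ∀ i, ∀ w ∈ ball (0 : ℂ) 1, ‖u i w‖ ≤ C)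
    (huf : ∀ w ∈ ball (0 : ℂ) 1, ∑ i, u i w * f i w = 1) {z : ℂ} (hz : ‖z‖ < 1)
    {v : EuclideanSpace ℂ ι} (hv : ∑ i, f i z * v i = 0) :
    ∃ h ∈ rowKernel f, ⟪kernel z v, h⟫ = ((‖v‖ ^ 2 / (1 - ‖z‖ ^ 2) : ℝ) : ℂ) ∧
      ‖h‖ ^ 2 ≤ Fintype.card ι *
        ((‖v‖ * (1 + Fintype.card ι * C ^ 2)) ^ 2 / (1 - ‖z‖ ^ 2)) := by
  obtain ⟨h, hh, hle⟩ := exists_hardyTwo_mul_kernel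
    (g := fun i w => v i - u i w * ∑ j, f j w * v j)
    (C := ‖v‖ * (1 + Fintype.card ι * C ^ 2))
    (fun i => ((hu i).fun_mul (DifferentiableOn.fun_sum fun j _ => (hf j).mul_const _)).const_sub _)
    (fun i w hw => by
      have hC : 0 ≤ C := (norm_nonneg _).trans (hfC i w hw)
      have hsum : ‖∑ j, f j w * v j‖ ≤ Fintype.card ι * (C * ‖v‖) := by
        refine (norm_sum_le_of_le (f := fun j => f j w * v j) (n := fun _ => C * ‖v‖) _
          fun j _ => ?_).trans_eq (by simp)
        rw [norm_mul]
        exact mul_le_mul (hfC j w hw) (PiLp.norm_apply_le v j) (norm_nonneg _) hC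
      calc _ ≤ ‖v i‖ + ‖u i w * ∑ j, f j w * v j‖ := norm_sub_le _ _
        _ ≤ ‖v‖ + C * (Fintype.card ι * (C * ‖v‖)) := by
          rw [norm_mul]
          exact add_le_add (PiLp.norm_apply_le v i)
            (mul_le_mul (huC i w hw) hsum (norm_nonneg _) hC)
        _ = _ := by ring) hz
  refine ⟨h, mem_rowKernel.2 fun w hw => ?_, ?_, hle⟩
  · rw [hh w hw]
    have : ∑ i, (v i - u i w * ∑ j, f j w * v j) * f i w = 0 := by
      have h1 : ∀ i, (v i - u i w * ∑ j, f j w * v j) * f i w =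
          f i w * v i - u i w * f i w * ∑ j, f j w * v j := fun i => by ring
      simp_rw [h1]
      rw [Finset.sum_sub_distrib, ← Finset.sum_mul, huf w hw, one_mul, sub_self]
    simp [conjRow, this]
  · rw [hh z (by simpa using hz), hv, Complex.conj_mul', div_eq_mul_inv]
    have : ∑ i, v i * conj (v i) = ((‖v‖ ^ 2 : ℝ) : ℂ) := by
      rw [EuclideanSpace.norm_sq_eq]
      simp [Complex.mul_conj']
    simp only [mul_zero, sub_zero]
    rw [this]
    push_cast
    rfl

lemma norm_sq_le_norm_sq_starProjection_rowWandering {f u : ι → ℂ → ℂ}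
    (hf : ∀ i, DifferentiableOn ℂ (f i) (ball 0 1))
    (hu : ∀ i, DifferentiableOn ℂ (u i) (ball 0 1)) {C : ℝ}
    (hfC : ∀ i, ∀ w ∈ ball (0 : ℂ) 1, ‖f i w‖ ≤ C) (huC : ∀ i, ∀ w ∈ ball (0 : ℂ) 1, ‖u i w‖ ≤ C)
    (huf : ∀ w ∈ ball (0 : ℂ) 1, ∑ i, u i w * f i w = 1)
    [(rowWandering f).HasOrthogonalProjection] {z : ℂ} (hz : ‖z‖ < 1)
    {v : EuclideanSpace ℂ ι} (hv : ∑ i, f i z * v i = 0) :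
    ‖v‖ ^ 2 ≤ Fintype.card ι * (1 + Fintype.card ι * C ^ 2) ^ 2 *
      ‖(rowWandering f).starProjection (kernel z v)‖ ^ 2 := by
  obtain ⟨h, hN, hk, hle⟩ := exists_mem_rowKernel hf hu hfC huC huf hz hv
  rw [norm_sq_starProjection_rowWandering f hz]
  set q := (rowKernel f).starProjection (kernel z v)
  have hq : ⟪q, h⟫ = ⟪kernel z v, h⟫ := by
    have := Submodule.starProjection_inner_eq_zero (kernel z v) h hN
    rw [inner_sub_left, sub_eq_zero] at this
    exact this.symm
  have hz' := sub_pos.2 (norm_sq_lt_one hz)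
  have hcs : ‖v‖ ^ 2 / (1 - ‖z‖ ^ 2) ≤ ‖q‖ * ‖h‖ := by
    have := norm_inner_le_norm (𝕜 := ℂ) q h
    rwa [hq, hk, Complex.norm_of_nonneg (by positivity)] at this
  rcases eq_or_ne v 0 with rfl | hv0
  · rw [norm_zero, zero_pow two_ne_zero]
    exact mul_nonneg (by positivity) (mul_nonneg hz'.le (sq_nonneg _))
  have hvpos : 0 < ‖v‖ ^ 2 := by positivity
  have h2 := pow_le_pow_left₀ (by positivity) hcs 2
  rw [mul_pow] at h2
  have h3 := h2.trans (mul_le_mul_of_nonneg_left hle (sq_nonneg ‖q‖))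
  rw [div_pow, div_le_iff₀ (by positivity)] at h3
  refine le_of_mul_le_mul_left ?_ hvpos
  refine (le_of_eq (by ring)).trans (h3.trans_eq ?_)
  field_simp

lemma finrank_rowWandering {f u : ι → ℂ → ℂ}
    (hf : ∀ i, DifferentiableOn ℂ (f i) (ball 0 1))
    (hu : ∀ i, DifferentiableOn ℂ (u i) (ball 0 1)) {C : ℝ}
    (hfC : ∀ i, ∀ w ∈ ball (0 : ℂ) 1, ‖f i w‖ ≤ C) (huC : ∀ i, ∀ w ∈ ball (0 : ℂ) 1, ‖u i w‖ ≤ C)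
    (huf : ∀ w ∈ ball (0 : ℂ) 1, ∑ i, u i w * f i w = 1) :
    1 + Module.finrank ℂ (rowWandering f) = Fintype.card ι := by
  have := finiteDimensional_rowWandering hf
  have hne : conjRow f 0 ≠ 0 := fun h0 => by
    have h1 : ∀ i, f i 0 = 0 := fun i => by
      simpa [conjRow] using congrArg (fun x : EuclideanSpace ℂ ι => x i) h0
    simpa [h1] using huf 0 (by simp)
  have hF := Submodule.finrank_add_finrank_orthogonal (ℂ ∙ conjRow f 0)
  rw [finrank_span_singleton hne, finrank_euclideanSpace] at hF
  rw [← hF]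
  congr 1
  refine le_antisymm (LinearMap.finrank_le_finrank_of_injective (wanderingEval_injective hf)) ?_
  set T : (ℂ ∙ conjRow f 0)ᗮ →ₗ[ℂ] rowWandering f :=
    (rowWandering f).orthogonalProjectionOnto.toLinearMap ∘ₗ kernel 0 ∘ₗ Submodule.subtype _
  refine LinearMap.finrank_le_finrank_of_injective (f := T) ?_
  rw [injective_iff_map_eq_zero]
  intro v hv
  have hv0 : ∑ i, f i 0 * (v : EuclideanSpace ℂ ι) i = 0 := by
    rw [← inner_conjRow]
    exact Submodule.mem_orthogonal_singleton_iff_inner_right.1 v.2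
  have h1 := norm_sq_le_norm_sq_starProjection_rowWandering hf hu hfC huC huf (z := 0) (by simp) hv0
  have h2 : (rowWandering f).starProjection (kernel 0 (v : EuclideanSpace ℂ ι)) = 0 :=
    congrArg Subtype.val hv
  rw [h2] at h1
  have h3 : ‖(v : EuclideanSpace ℂ ι)‖ ^ 2 ≤ 0 := by simpa using h1
  exact Subtype.ext (by simpa using h3)

end KernelOfRow

section Completion

open Metric HardyTwo Matrix

/-- If `f ᵥ* X` is the first unit vector and the remaining columns of `X` are bounded below on the
conjugate orthogonal complement of `f`, then `X` is bounded below. -/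
lemma norm_le_of_norm_vecMul_le {m : ℕ} {X : Matrix (Fin (m + 1)) (Fin (m + 1)) ℂ}
    {f : Fin (m + 1) → ℂ} (hfX : f ᵥ* X = Pi.single 0 1) {C : ℝ} (hf : ∀ i, ‖f i‖ ≤ C)
    (hX : ∀ i, ‖X i 0‖ ≤ C) {B : ℝ} (hB : 0 ≤ B)
    (h : ∀ v : Fin (m + 1) → ℂ, ∑ i, f i * conj (v i) = 0 →
      ∑ i, ‖v i‖ ^ 2 ≤ B * ∑ j : Fin m, ‖(v ᵥ* X) j.succ‖ ^ 2)
    {w : Fin (m + 1) → ℂ} {ε : ℝ} (hw : ∀ j, ‖(w ᵥ* X) j‖ ≤ ε) (i : Fin (m + 1)) :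
    ‖w i‖ ≤ (√(B * m) + (1 + (m + 1) * (√(B * m) * C)) * C) * ε := by
  have hε : 0 ≤ ε := (norm_nonneg _).trans (hw 0)
  have hC : 0 ≤ C := (norm_nonneg _).trans (hf 0)
  set s : ℂ := ∑ i, f i * conj (f i) with hs
  have hs0 : s ≠ 0 := by
    intro h0
    have h1 : s = ((∑ i, ‖f i‖ ^ 2 : ℝ) : ℂ) := by simp [hs, Complex.mul_conj']
    have h2 : ∑ i, ‖f i‖ ^ 2 = 0 := by exact_mod_cast h1.symm.trans h0
    rw [Finset.sum_eq_zero_iff_of_nonneg fun _ _ => by positivity] at h2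
    have h3 : f = 0 := funext fun i => by simpa using h2 i (Finset.mem_univ i)
    have := congrFun hfX 0
    simp [h3] at this
  have hsconj : conj s = s := by simp [hs, mul_comm]
  set t : ℂ := (∑ i, w i * conj (f i)) / s with ht
  set v : Fin (m + 1) → ℂ := w - t • f with hv
  have hwv : w = v + t • f := by simp [hv]
  have hvX : v ᵥ* X = w ᵥ* X - t • Pi.single 0 1 := by
    rw [hv, sub_vecMul, smul_vecMul, hfX]
  have horth : ∑ i, f i * conj (v i) = 0 := by
    have h1 : ∀ i, f i * conj (v i) = conj (w i * conj (f i)) - conj t * (f i * conj (f i)) :=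
      fun i => by simp [hv]; ring
    simp_rw [h1]
    rw [Finset.sum_sub_distrib, ← Finset.mul_sum, ← hs, ← map_sum, ht, map_div₀, hsconj,
      div_mul_cancel₀ _ hs0, sub_self]
  have hvle : ∀ i, ‖v i‖ ≤ √(B * m) * ε := by
    intro i
    have h1 : ‖v i‖ ^ 2 ≤ B * m * ε ^ 2 := by
      calc ‖v i‖ ^ 2 ≤ ∑ i, ‖v i‖ ^ 2 :=
            Finset.single_le_sum (f := fun i => ‖v i‖ ^ 2) (fun _ _ => by positivity)
              (Finset.mem_univ i)
        _ ≤ B * ∑ j : Fin m, ‖(v ᵥ* X) j.succ‖ ^ 2 := h v horth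
        _ ≤ B * (m * ε ^ 2) := by
          gcongr
          refine (Finset.sum_le_card_nsmul _ _ (ε ^ 2) fun j _ => ?_).trans_eq (by simp)
          rw [hvX]
          simpa using pow_le_pow_left₀ (norm_nonneg _) (hw j.succ) 2
        _ = _ := by ring
    refine (Real.le_sqrt (norm_nonneg _) (by positivity)).2 h1 |>.trans_eq ?_
    rw [Real.sqrt_mul (by positivity), Real.sqrt_sq hε]
  have htle : ‖t‖ ≤ (1 + (m + 1) * (√(B * m) * C)) * ε := by
    have h1 : t = (w ᵥ* X) 0 - ∑ i, v i * X i 0 := by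
      have : (v ᵥ* X) 0 = (w ᵥ* X) 0 - t := by rw [hvX]; simp
      change (∑ i, v i * X i 0) = _ at this
      rw [this]; ring
    have h2 : ‖∑ i, v i * X i 0‖ ≤ (m + 1) * (√(B * m) * ε * C) := by
      refine (norm_sum_le_of_le (f := fun i => v i * X i 0) (n := fun _ => √(B * m) * ε * C) _
        fun j _ => ?_).trans_eq (by simp)
      rw [norm_mul]
      exact mul_le_mul (hvle j) (hX j) (norm_nonneg _) (by positivity)
    rw [h1]
    refine (norm_sub_le _ _).trans ((add_le_add (hw 0) h2).trans_eq ?_)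
    ring
  calc ‖w i‖ = ‖v i + t * f i‖ := by rw [hwv]; simp
    _ ≤ ‖v i‖ + ‖t‖ * ‖f i‖ := (norm_add_le _ _).trans_eq (by rw [norm_mul])
    _ ≤ √(B * m) * ε + (1 + (m + 1) * (√(B * m) * C)) * ε * C :=
      add_le_add (hvle i) (mul_le_mul htle (hf i) (norm_nonneg _) (by positivity))
    _ = _ := by ring

lemma isUnit_det_of_norm_vecMul_le {n : Type*} [Fintype n] [DecidableEq n] {X : Matrix n n ℂ}
    {D : ℝ} (h : ∀ (w : n → ℂ) (ε : ℝ), (∀ j, ‖(w ᵥ* X) j‖ ≤ ε) → ∀ i, ‖w i‖ ≤ D * ε) :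
    IsUnit X.det := by
  rw [isUnit_iff_ne_zero]
  intro h0
  obtain ⟨w, hw0, hw⟩ := exists_vecMul_eq_zero_iff.2 h0
  exact hw0 (funext fun i => by simpa using h w 0 (by simp [hw]) i)

/-- Tolokonnikov's lemma for rows over the disk: a unimodular row is the first row of an
invertible matrix, with bounds depending only on the size of the row and the bounds of the
unimodularity data. -/
lemma exists_completion_disk (m : ℕ) (C : ℝ) :
    ∃ D : ℝ, ∀ f u : Fin (m + 1) → ℂ → ℂ,
      (∀ i, DifferentiableOn ℂ (f i) (ball 0 1)) → (∀ i, DifferentiableOn ℂ (u i) (ball 0 1)) →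
      (∀ i, ∀ z ∈ ball (0 : ℂ) 1, ‖f i z‖ ≤ C) → (∀ i, ∀ z ∈ ball (0 : ℂ) 1, ‖u i z‖ ≤ C) →
      (∀ z ∈ ball (0 : ℂ) 1, ∑ i, u i z * f i z = 1) →
      ∃ A B : ℂ → Matrix (Fin (m + 1)) (Fin (m + 1)) ℂ,
        (∀ i j, DifferentiableOn ℂ (fun z => A z i j) (ball 0 1)) ∧
        (∀ i j, DifferentiableOn ℂ (fun z => B z i j) (ball 0 1)) ∧
        ∀ z ∈ ball (0 : ℂ) 1, (∀ i j, ‖A z i j‖ ≤ D) ∧ (∀ i j, ‖B z i j‖ ≤ D) ∧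
          (∀ j, A z 0 j = f j z) ∧ A z * B z = 1 ∧ B z * A z = 1 := by
  let K : ℝ := (m + 1) * (1 + (m + 1) * C ^ 2) ^ 2
  let D : ℝ := √(K * m) + (1 + (m + 1) * (√(K * m) * C)) * C
  refine ⟨max D (max C 1), fun f u hf hu hfC huC huf => ?_⟩
  have hfin := finiteDimensional_rowWandering hf
  have hrank : Module.finrank ℂ (rowWandering f) = m := by
    have := finrank_rowWandering hf hu hfC huC huf
    rw [Fintype.card_fin] at this
    omega
  let b : OrthonormalBasis (Fin m) ℂ (rowWandering f) :=
    (stdOrthonormalBasis ℂ (rowWandering f)).reindex (finCongr hrank)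
  let X : ℂ → Matrix (Fin (m + 1)) (Fin (m + 1)) ℂ := fun z => Matrix.of fun i j =>
    Fin.cons (α := fun _ => ℂ) (u i z) (fun j : Fin m =>
      ⟪kernel z (EuclideanSpace.single i (1 : ℂ)), (b j : HardyTwo _)⟫) j
  have hX0 : ∀ z i, X z i 0 = u i z := fun z i => rfl
  have hXs : ∀ z i (j : Fin m), X z i j.succ =
    ⟪kernel z (EuclideanSpace.single i (1 : ℂ)), (b j : HardyTwo _)⟫ := fun z i j => rfl
  have hXv : ∀ z (v : Fin (m + 1) → ℂ) (j : Fin m), (v ᵥ* X z) j.succ =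
      ⟪kernel z (WithLp.toLp 2 fun i => (starRingEnd ℂ) (v i)), (b j : HardyTwo _)⟫ := by
    intro z v j
    rw [inner_kernel_eq_sum]
    simp [vecMul, dotProduct, hXs]
  have hproj : ∀ x : HardyTwo (EuclideanSpace ℂ (Fin (m + 1))), ∀ j : Fin m,
      ⟪x, (b j : HardyTwo _)⟫ = ⟪(rowWandering f).orthogonalProjectionOnto x, b j⟫ := by
    intro x j
    exact (Submodule.inner_orthogonalProjectionOnto_eq_of_mem_right (b j) x).symm
  have hXdiff : ∀ i j, DifferentiableOn ℂ (fun z => X z i j) (ball 0 1) := by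
    intro i j
    refine Fin.cases ?_ (fun j => ?_) j
    · exact hu i
    · exact differentiableOn_inner_kernel _ _
  have hXC : ∀ z ∈ ball (0 : ℂ) 1, ∀ i j, ‖X z i j‖ ≤ max C 1 := by
    intro z hz i j
    refine Fin.cases ?_ (fun j => ?_) j
    · exact (huC i z hz).trans (le_max_left _ _)
    · rw [hXs, hproj]
      refine (norm_inner_le_norm _ _).trans (le_trans ?_ (le_max_right _ _))
      rw [b.norm_eq_one, mul_one]
      exact (norm_starProjection_rowWandering_le f (by simpa using hz) _).trans (by simp)
  have hfX : ∀ z ∈ ball (0 : ℂ) 1, (fun i => f i z) ᵥ* X z = Pi.single 0 1 := by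
    intro z hz
    ext j
    refine Fin.cases ?_ (fun j => ?_) j
    · simpa [vecMul, dotProduct, hX0, mul_comm] using huf z hz
    · rw [hXv, Pi.single_eq_of_ne (Fin.succ_ne_zero j)]
      exact mem_rowKernel.1 (b j).2.1 z hz
  have hbelow : ∀ z ∈ ball (0 : ℂ) 1, ∀ (w : Fin (m + 1) → ℂ) (ε : ℝ),
      (∀ j, ‖(w ᵥ* X z) j‖ ≤ ε) → ∀ i, ‖w i‖ ≤ D * ε := by
    intro z hz w ε hw
    refine norm_le_of_norm_vecMul_le (hfX z hz) (fun i => hfC i z hz) (fun i => huC i z hz)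
      (by positivity) (fun v hv => ?_) hw
    have h1 := norm_sq_le_norm_sq_starProjection_rowWandering hf hu hfC huC huf
      (z := z) (by simpa using hz) (v := WithLp.toLp 2 fun i => (starRingEnd ℂ) (v i)) hv
    have h2 : ∑ j : Fin m, ‖(v ᵥ* X z) j.succ‖ ^ 2 = ‖(rowWandering f).starProjection
        (kernel z (WithLp.toLp 2 fun i => (starRingEnd ℂ) (v i)))‖ ^ 2 := by
      refine Eq.trans ?_ (b.sum_sq_norm_inner_left _)
      exact Finset.sum_congr rfl fun j _ => by rw [hXv, hproj]; rfl
    have h3 : ∑ i, ‖v i‖ ^ 2 = ‖WithLp.toLp 2 fun i => (starRingEnd ℂ) (v i)‖ ^ 2 := by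
      rw [EuclideanSpace.norm_sq_eq]
      exact Finset.sum_congr rfl fun i _ => by rw [RCLike.norm_conj]
    rw [Fintype.card_fin, Nat.cast_succ, ← h2, ← h3] at h1
    exact h1
  have hunit : ∀ z ∈ ball (0 : ℂ) 1, IsUnit (X z).det := fun z hz =>
    isUnit_det_of_norm_vecMul_le (hbelow z hz)
  have hdet : ∀ Y : ℂ → Matrix (Fin (m + 1)) (Fin (m + 1)) ℂ,
      (∀ i j, DifferentiableOn ℂ (fun z => Y z i j) (ball 0 1)) →
      DifferentiableOn ℂ (fun z => (Y z).det) (ball 0 1) := by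
    intro Y hY
    simp_rw [det_apply]
    exact DifferentiableOn.fun_sum fun σ _ =>
      (DifferentiableOn.fun_finsetProd fun i _ => hY _ _).const_smul _
  refine ⟨fun z => (X z)⁻¹, X, fun i j => ?_, hXdiff, fun z hz => ⟨fun i j => ?_, fun i j =>
    (hXC z hz i j).trans (le_max_right _ _), fun j => ?_, nonsing_inv_mul _ (hunit z hz),
    mul_nonsing_inv _ (hunit z hz)⟩⟩
  · simp_rw [inv_def, Matrix.smul_apply, Ring.inverse_eq_inv', smul_eq_mul, adjugate_apply]
    refine ((hdet X hXdiff).inv fun z hz => (hunit z hz).ne_zero).mul (hdet _ fun k l => ?_)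
    by_cases hk : k = j
    · subst hk
      simp
    · simpa [updateRow_ne hk] using hXdiff k l
  · have h1 := hbelow z hz ((X z)⁻¹ i) 1 (fun k => ?_) j
    · exact (h1.trans_eq (mul_one D)).trans (le_max_left _ _)
    · have h2 : ((X z)⁻¹ i ᵥ* X z) k = (1 : Matrix _ _ ℂ) i k := by
        rw [← nonsing_inv_mul _ (hunit z hz)]
        rfl
      rw [h2, one_apply]
      split_ifs <;> simp
  · have h1 : (fun i => f i z) = Pi.single 0 1 ᵥ* (X z)⁻¹ := by
      rw [← hfX z hz, vecMul_vecMul, mul_nonsing_inv _ (hunit z hz), vecMul_one]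
    rw [show f j z = (fun i => f i z) j from rfl, h1]
    simp

end Completion

lemma MemHinfN.exists_common_bound {ι : Type*} [Finite ι] {f : ι → ℂ → ℕ → ℂ}
    (hf : ∀ i, MemHinfN (f i)) :
    ∃ C : ℝ, ∀ i, ∀ z ∈ Metric.ball (0 : ℂ) 1, ∀ k, ‖f i z k‖ ≤ C := by
  choose M hM using fun i => (hf i).2
  obtain ⟨C, hC⟩ := Finite.exists_le M
  exact ⟨C, fun i z hz k => (hM i z hz k).trans (hC i)⟩

/-- **`H^∞(𝔻 × ℕ)` is Hermite.** Every unimodular row `(f₁, …, fₙ)` over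
`H^∞(𝔻 × ℕ)` (i.e. `u₁f₁ + ⋯ + uₙfₙ = 1` for some `uᵢ ∈ H^∞(𝔻 × ℕ)`) can be
completed to an `n × n` matrix `A` with entries in `H^∞(𝔻 × ℕ)`, first row
`(f₁, …, fₙ)`, which is invertible over `H^∞(𝔻 × ℕ)`: there is a matrix `B`
with entries in `H^∞(𝔻 × ℕ)` with `A·B = B·A = Iₙ`. -/
theorem HinfN_Hermite (n : ℕ) (hn : 1 ≤ n)
    (f : Fin n → ℂ → ℕ → ℂ) (hf : ∀ i, MemHinfN (f i))
    (hunim : ∃ u : Fin n → ℂ → ℕ → ℂ, (∀ i, MemHinfN (u i)) ∧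
      ∀ z ∈ Metric.ball (0 : ℂ) 1, ∀ m : ℕ,
        ∑ i : Fin n, u i z m * f i z m = 1) :
    ∃ A B : Fin n → Fin n → ℂ → ℕ → ℂ,
      (∀ i j, MemHinfN (A i j)) ∧
      (∀ i j, MemHinfN (B i j)) ∧
      (∀ j, ∀ z ∈ Metric.ball (0 : ℂ) 1, ∀ m : ℕ,
        A ⟨0, hn⟩ j z m = f j z m) ∧
      (∀ z ∈ Metric.ball (0 : ℂ) 1, ∀ m : ℕ, ∀ i j : Fin n,
        ∑ k : Fin n, A i k z m * B k j z m = if i = j then 1 else 0) ∧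
      (∀ z ∈ Metric.ball (0 : ℂ) 1, ∀ m : ℕ, ∀ i j : Fin n,
        ∑ k : Fin n, B i k z m * A k j z m = if i = j then 1 else 0) := by
  obtain ⟨u, hu, huf⟩ := hunim
  obtain ⟨m, rfl⟩ : ∃ m, n = m + 1 := ⟨n - 1, by omega⟩
  obtain ⟨C₁, hC₁⟩ := MemHinfN.exists_common_bound hf
  obtain ⟨C₂, hC₂⟩ := MemHinfN.exists_common_bound hu
  obtain ⟨D, hD⟩ := exists_completion_disk m (max C₁ C₂)
  choose A B hA hB hAB using fun k => hD (fun i z => f i z k) (fun i z => u i z k)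
    (fun i => (hf i).1 k) (fun i => (hu i).1 k)
    (fun i z hz => (hC₁ i z hz k).trans (le_max_left _ _))
    (fun i z hz => (hC₂ i z hz k).trans (le_max_right _ _)) (fun z hz => huf z hz k)
  refine ⟨fun i j z k => A k z i j, fun i j z k => B k z i j,
    fun i j => ⟨fun k => hA k i j, D, fun z hz k => (hAB k z hz).1 i j⟩,
    fun i j => ⟨fun k => hB k i j, D, fun z hz k => (hAB k z hz).2.1 i j⟩,
    fun j z hz k => (hAB k z hz).2.2.1 j, fun z hz k i j => ?_, fun z hz k i j => ?_⟩
  · rw [← Matrix.mul_apply, (hAB k z hz).2.2.2.1, Matrix.one_apply]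
  · rw [← Matrix.mul_apply, (hAB k z hz).2.2.2.2, Matrix.one_apply]
end

section
/- Let A = H∞(𝔻×ℕ) with maximal ideal space M(A). Suppose K ⊆ M(A) is a compact holomorphically convex subset and Z ⊆ M(A) is a hull, i.e., Z = {ξ ∈ M(A) : f̂(ξ) = 0 for all f ∈ I} for some proper ideal I ⊆ A. Then K ∪ Z is holomorphically convex: for every ξ ∈ M(A)∖(K ∪ Z) there exists h ∈ A with max_{η∈K∪Z}|ĥ(η)| < |ĥ(ξ)|. -/
/-- The unit disk times `ℕ`: the countable disjoint union of open unit disks. -/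
abbrev DiskN := (↥(Metric.ball (0 : ℂ) 1)) × ℕ

/-- The Banach algebra `A = H^∞(𝔻 × ℕ)` of bounded continuous functions on
`𝔻 × ℕ` all of whose slices `z ↦ f (z, n)` are holomorphic on `𝔻`, realized as
a subalgebra of the bounded continuous functions `𝔻 × ℕ → ℂ` (with sup norm). -/
noncomputable def HinfAlg : Subalgebra ℂ (BoundedContinuousFunction DiskN ℂ) where
  carrier := {f | ∀ n : ℕ, ∃ g : ℂ → ℂ, DifferentiableOn ℂ g (Metric.ball 0 1) ∧
    ∀ z : ℂ, ∀ hz : z ∈ Metric.ball (0 : ℂ) 1, g z = f (⟨z, hz⟩, n)}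
  add_mem' := by
    intro f₁ f₂ h₁ h₂ n
    obtain ⟨g₁, hg₁, he₁⟩ := h₁ n
    obtain ⟨g₂, hg₂, he₂⟩ := h₂ n
    exact ⟨g₁ + g₂, hg₁.add hg₂, fun z hz => by simp [he₁ z hz, he₂ z hz]⟩
  mul_mem' := by
    intro f₁ f₂ h₁ h₂ n
    obtain ⟨g₁, hg₁, he₁⟩ := h₁ n
    obtain ⟨g₂, hg₂, he₂⟩ := h₂ n
    exact ⟨g₁ * g₂, hg₁.mul hg₂, fun z hz => by simp [he₁ z hz, he₂ z hz]⟩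
  algebraMap_mem' := by
    intro c n
    exact ⟨fun _ => c, differentiableOn_const c, fun z hz => by simp⟩

/-- **Union of a holomorphically convex set and a hull is holomorphically
convex.** Let `A = H^∞(𝔻 × ℕ)` with maximal ideal space `M(A)` (character space
with the Gelfand topology), and write `f̂(ξ) = ξ f` for the Gelfand transform.
Suppose `K ⊆ M(A)` is compact and holomorphically convex (for every `ξ ∉ K`
there is `f ∈ A` with `max_{η ∈ K} |f̂(η)| < |f̂(ξ)|`) and `Z ⊆ M(A)` is a hull,
i.e. the common zero set of the Gelfand transforms of the elements of some
proper ideal `I ⊆ A`. Then `K ∪ Z` is holomorphically convex: for every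
`ξ ∉ K ∪ Z` there is `h ∈ A` with `max_{η ∈ K ∪ Z} |ĥ(η)| < |ĥ(ξ)|`. -/
theorem HinfN_holConvex_union_hull
    (K Z : Set (WeakDual.characterSpace ℂ ↥HinfAlg))
    (hKcompact : IsCompact K)
    (hKconv : ∀ ξ : WeakDual.characterSpace ℂ ↥HinfAlg, ξ ∉ K →
      ∃ f : ↥HinfAlg, ∃ c : ℝ, (∀ η ∈ K, ‖η f‖ ≤ c) ∧ c < ‖ξ f‖)
    (hZ : ∃ I : Ideal ↥HinfAlg, I ≠ ⊤ ∧
      Z = {ξ : WeakDual.characterSpace ℂ ↥HinfAlg | ∀ f ∈ I, ξ f = 0}) :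
    ∀ ξ : WeakDual.characterSpace ℂ ↥HinfAlg, ξ ∉ K ∪ Z →
      ∃ h : ↥HinfAlg, ∃ c : ℝ, (∀ η ∈ K ∪ Z, ‖η h‖ ≤ c) ∧ c < ‖ξ h‖ := by
  obtain ⟨I, -, rfl⟩ := hZ
  intro ξ hξ
  simp only [Set.mem_union, Set.mem_ofPred_eq, not_or, not_forall] at hξ
  obtain ⟨hξK, g, hgI, hg⟩ := hξ
  have hm : 0 < ‖ξ g‖ := norm_pos_iff.mpr hg
  rcases K.eq_empty_or_nonempty with rfl | ⟨η₀, hη₀⟩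
  · refine ⟨g, 0, fun η hη => ?_, hm⟩
    rcases hη with hη | hη
    · exact hη.elim
    · simp [hη g hgI]
  obtain ⟨f, c, hfc, hcf⟩ := hKconv ξ hξK
  have hc : 0 ≤ c := (norm_nonneg _).trans (hfc η₀ hη₀)
  have hr : 0 < ‖ξ f‖ := hc.trans_lt hcf
  have hcont : Continuous fun η : WeakDual.characterSpace ℂ ↥HinfAlg => η g :=
    (WeakDual.eval_continuous g).comp continuous_subtype_val
  obtain ⟨M, hM⟩ := hKcompact.exists_bound_of_continuousOn hcont.continuousOn
  have hM0 : 0 ≤ M := (norm_nonneg _).trans (hM η₀ hη₀)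
  obtain ⟨n, hn⟩ := exists_pow_lt_of_lt_one (y := c / ‖ξ f‖)
    (div_pos hm (by positivity : 0 < M + 1)) ((div_lt_one hr).mpr hcf)
  refine ⟨f ^ n * g, c ^ n * M, fun η hη => ?_, ?_⟩
  · rcases hη with hη | hη
    · rw [map_mul, map_pow, norm_mul, norm_pow]
      have := hfc η hη
      have := hM η hη
      gcongr
    · rw [map_mul, hη g hgI, mul_zero, norm_zero]
      positivity
  · rw [map_mul, map_pow, norm_mul, norm_pow]
    rw [div_pow, div_lt_div_iff₀ (by positivity) (by positivity)] at hn
    have : 0 ≤ c ^ n := by positivity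
    linarith
end

section
/- Suppose that for a fixed δ > 0 the following qualitative statement holds: for every pair f, g ∈ H∞(𝔻×ℕ) with ‖f‖ ≤ 1, ‖g‖ ≤ 1 and inf_{(z,n)∈𝔻×ℕ}(|f(z,n)| + |g(z,n)|) ≥ δ there exists G ∈ H∞(𝔻×ℕ) such that f + gG is invertible in H∞(𝔻×ℕ). Then there exists a constant C > 0 (depending only on δ) such that for every such pair f, g one can choose G ∈ H∞(𝔻×ℕ) with ‖G‖ ≤ C and inf_{(z,n)∈𝔻×ℕ}|f(z,n) + g(z,n)G(z,n)| ≥ 1/C. -/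
/-- The function on `𝔻 × ℕ` whose restriction to the `k`-th part of
`𝔻 × (ℕ × ℕ) ≃ 𝔻 × ℕ` is `f k`. -/
def glueHinfN (f : ℕ → ℂ → ℕ → ℂ) (z : ℂ) (m : ℕ) : ℂ :=
  f m.unpair.1 z m.unpair.2

@[simp]
theorem glueHinfN_pair (f : ℕ → ℂ → ℕ → ℂ) (z : ℂ) (k n : ℕ) :
    glueHinfN f z (Nat.pair k n) = f k z n := by
  simp [glueHinfN]

theorem memHinfN_glueHinfN {f : ℕ → ℂ → ℕ → ℂ} (hf : ∀ k, MemHinfN (f k)) {M : ℝ}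
    (hM : ∀ k, ∀ z ∈ Metric.ball (0 : ℂ) 1, ∀ n : ℕ, ‖f k z n‖ ≤ M) :
    MemHinfN (glueHinfN f) :=
  ⟨fun m => (hf m.unpair.1).1 m.unpair.2, M, fun z hz m => hM m.unpair.1 z hz m.unpair.2⟩

/-- **From a qualitative to a quantitative stable rank one statement.**
Fix `δ > 0` and assume that for every `f, g ∈ H^∞(𝔻 × ℕ)` with `‖f‖ ≤ 1`,
`‖g‖ ≤ 1` and `|f(z,n)| + |g(z,n)| ≥ δ` everywhere, there exists
`G ∈ H^∞(𝔻 × ℕ)` such that `f + g·G` is invertible in `H^∞(𝔻 × ℕ)`. Then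
there is a constant `C > 0` (depending only on `δ`) such that for every such
pair one may choose `G` with `‖G‖ ≤ C` and
`inf_{(z,n)} |f(z,n) + g(z,n)·G(z,n)| ≥ 1/C`. -/
theorem HinfN_qualitative_to_quantitative (δ : ℝ) (hδ : 0 < δ)
    (hqual : ∀ f g : ℂ → ℕ → ℂ,
      MemHinfN f → MemHinfN g →
      (∀ z ∈ Metric.ball (0 : ℂ) 1, ∀ n : ℕ, ‖f z n‖ ≤ 1) →
      (∀ z ∈ Metric.ball (0 : ℂ) 1, ∀ n : ℕ, ‖g z n‖ ≤ 1) →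
      (∀ z ∈ Metric.ball (0 : ℂ) 1, ∀ n : ℕ, δ ≤ ‖f z n‖ + ‖g z n‖) →
      ∃ G : ℂ → ℕ → ℂ, MemHinfN G ∧
        ∃ ε : ℝ, 0 < ε ∧ ∀ z ∈ Metric.ball (0 : ℂ) 1, ∀ n : ℕ,
          ε ≤ ‖f z n + g z n * G z n‖) :
    ∃ C : ℝ, 0 < C ∧
      ∀ f g : ℂ → ℕ → ℂ,
        MemHinfN f → MemHinfN g →
        (∀ z ∈ Metric.ball (0 : ℂ) 1, ∀ n : ℕ, ‖f z n‖ ≤ 1) →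
        (∀ z ∈ Metric.ball (0 : ℂ) 1, ∀ n : ℕ, ‖g z n‖ ≤ 1) →
        (∀ z ∈ Metric.ball (0 : ℂ) 1, ∀ n : ℕ, δ ≤ ‖f z n‖ + ‖g z n‖) →
        ∃ G : ℂ → ℕ → ℂ, MemHinfN G ∧
          (∀ z ∈ Metric.ball (0 : ℂ) 1, ∀ n : ℕ, ‖G z n‖ ≤ C) ∧
          (∀ z ∈ Metric.ball (0 : ℂ) 1, ∀ n : ℕ,
            1 / C ≤ ‖f z n + g z n * G z n‖) := by
  by_contra hcon
  have hbad (k : ℕ) := not_exists.mp hcon (k + 1 : ℝ)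
  simp only [not_and, not_forall] at hbad
  choose f g hf hg hf1 hg1 hfg hno using fun k => hbad k (by positivity)
  obtain ⟨G, ⟨hG, M, hM⟩, ε, hε, hinv⟩ := hqual (glueHinfN f) (glueHinfN g)
    (memHinfN_glueHinfN hf hf1) (memHinfN_glueHinfN hg hg1)
    (fun z hz m => hf1 _ z hz _) (fun z hz m => hg1 _ z hz _) (fun z hz m => hfg _ z hz _)
  obtain ⟨k, hk⟩ := exists_nat_gt (max M (1 / ε))
  have hMk : M ≤ k + 1 := by linarith [le_max_left M (1 / ε)]
  have hεk : 1 / (k + 1 : ℝ) ≤ ε :=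
    (one_div_le hε (by positivity)).mp (by linarith [le_max_right M (1 / ε)])
  refine hno k ⟨fun z n => G z (Nat.pair k n), ⟨fun n => hG _, M, fun z hz n => hM z hz _⟩,
    fun z hz n => (hM z hz _).trans hMk, fun z hz n => hεk.trans ?_⟩
  simpa using hinv z hz (Nat.pair k n)
end

section
/- Let f : 𝔻 × ℕ → ℂ be a bounded function such that for each n ∈ ℕ the slice z ↦ f(z,n) is holomorphic on 𝔻. Then there exists a unique continuous function F : 𝔻 × βℕ → ℂ, where βℕ is the Stone–Čech compactification of the discrete space ℕ, such that F(z, ι(n)) = f(z,n) for all z ∈ 𝔻 and n ∈ ℕ (ι : ℕ → βℕ the canonical embedding); moreover sup_{(z,ξ)∈𝔻×βℕ}|F(z,ξ)| = sup_{(z,n)∈𝔻×ℕ}|f(z,n)|. -/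
open Metric Set in
/-- A bounded function on a discrete space with values in a proper metric space extends
continuously to the Stone–Čech compactification. -/
theorem exists_continuous_stoneCech_extension {X E : Type*} [TopologicalSpace X]
    [DiscreteTopology X] [MetricSpace E] [ProperSpace E] (g : X → E) {c : E} {M : ℝ}
    (hg : ∀ x, g x ∈ closedBall c M) :
    ∃ G : StoneCech X → E, Continuous G ∧ ∀ x, G (stoneCechUnit x) = g x := by
  have : CompactSpace (closedBall c M) := isCompact_iff_compactSpace.mp (isCompact_closedBall c M)
  have hc : Continuous fun x => (⟨g x, hg x⟩ : closedBall c M) := continuous_of_discreteTopology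
  exact ⟨Subtype.val ∘ stoneCechExtend hc,
    continuous_subtype_val.comp (continuous_stoneCechExtend hc),
    fun x => congrArg Subtype.val (stoneCechExtend_stoneCechUnit hc x)⟩

open Metric Set in
/-- A holomorphic function bounded by `M` on a ball is Lipschitz at the center, with a constant
that depends only on `M` and the radius. -/
theorem dist_le_mul_dist_of_norm_le_on_ball {g : ℂ → ℂ} {w z : ℂ} {r M : ℝ}
    (hd : DifferentiableOn ℂ g (ball w r)) (hM : ∀ z ∈ ball w r, ‖g z‖ ≤ M) (hz : z ∈ ball w r) :
    dist (g z) (g w) ≤ 2 * M / r * dist z w := by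
  have hw : w ∈ ball w r := mem_ball_self (pos_of_mem_ball hz)
  refine Complex.dist_le_div_mul_dist_of_mapsTo_ball hd (fun y hy => ?_) hz
  rw [mem_closedBall]
  calc dist (g y) (g w) ≤ ‖g y‖ + ‖g w‖ := dist_le_norm_add_norm _ _
    _ ≤ 2 * M := by linarith [hM y hy, hM w hw]

/-- **Extension to the fiberwise Stone–Čech compactification.** Let
`f : 𝔻 × ℕ → ℂ` be bounded with all slices `z ↦ f z n` holomorphic on the open
unit disk `𝔻`. Then there is a unique continuous function `F` on `𝔻 × βℕ`
(`βℕ` = the Stone–Čech compactification of the discrete space `ℕ`) with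
`F (z, ι n) = f z n` for all `z ∈ 𝔻`, `n ∈ ℕ`; moreover `F` and `f` have the
same sup norm, i.e. they have the same upper bounds:
`sup_{𝔻 × βℕ} |F| = sup_{𝔻 × ℕ} |f|`. -/
theorem HinfN_stoneCech_extension (f : ℂ → ℕ → ℂ)
    (hol : ∀ n : ℕ, DifferentiableOn ℂ (fun z => f z n) (Metric.ball 0 1))
    (bdd : ∃ M : ℝ, ∀ z ∈ Metric.ball (0 : ℂ) 1, ∀ n : ℕ, ‖f z n‖ ≤ M) :
    ∃ F : ℂ × StoneCech ℕ → ℂ,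
      ContinuousOn F (Metric.ball (0 : ℂ) 1 ×ˢ (Set.univ : Set (StoneCech ℕ))) ∧
      (∀ z ∈ Metric.ball (0 : ℂ) 1, ∀ n : ℕ, F (z, stoneCechUnit n) = f z n) ∧
      (∀ M : ℝ,
        (∀ z ∈ Metric.ball (0 : ℂ) 1, ∀ n : ℕ, ‖f z n‖ ≤ M) ↔
        (∀ z ∈ Metric.ball (0 : ℂ) 1, ∀ ξ : StoneCech ℕ, ‖F (z, ξ)‖ ≤ M)) ∧
      (∀ F' : ℂ × StoneCech ℕ → ℂ,
        ContinuousOn F'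
          (Metric.ball (0 : ℂ) 1 ×ˢ (Set.univ : Set (StoneCech ℕ))) →
        (∀ z ∈ Metric.ball (0 : ℂ) 1, ∀ n : ℕ, F' (z, stoneCechUnit n) = f z n) →
        ∀ z ∈ Metric.ball (0 : ℂ) 1, ∀ ξ : StoneCech ℕ, F' (z, ξ) = F (z, ξ)) := by
  have ext_on : ∀ z : ℂ, ∃ G : StoneCech ℕ → ℂ, z ∈ Metric.ball (0 : ℂ) 1 →
      Continuous G ∧ ∀ n, G (stoneCechUnit n) = f z n := by
    intro z
    by_cases hz : z ∈ Metric.ball (0 : ℂ) 1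
    · obtain ⟨M, hM⟩ := bdd
      obtain ⟨G, hG⟩ := exists_continuous_stoneCech_extension (f z)
        (fun n => mem_closedBall_zero_iff.mpr (hM z hz n))
      exact ⟨G, fun _ => hG⟩
    · exact ⟨0, fun h => absurd h hz⟩
  choose G hG using ext_on
  refine ⟨fun p => G p.1 p.2, ?_, fun z hz n => (hG z hz).2 n, fun M => ⟨fun h z hz ξ => ?_,
    fun h z hz n => (hG z hz).2 n ▸ h z hz (stoneCechUnit n)⟩, fun F' hF' hF'f z hz ξ => ?_⟩
  · obtain ⟨M, hM⟩ := bdd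
    rintro ⟨w, ξ₀⟩ ⟨hw, -⟩
    obtain ⟨r, hr, hball⟩ := Metric.isOpen_iff.mp Metric.isOpen_ball w hw
    have lip : ∀ z ∈ Metric.ball w r, ∀ ξ, dist (G z ξ) (G w ξ) ≤ 2 * M / r * dist z w := by
      intro z hz ξ
      refine denseRange_stoneCechUnit.induction_on ξ
        (isClosed_le ((hG z (hball hz)).1.dist (hG w hw).1) continuous_const) fun n => ?_
      rw [(hG z (hball hz)).2, (hG w hw).2]
      exact dist_le_mul_dist_of_norm_le_on_ball ((hol n).mono hball)
        (fun y hy => hM y (hball hy) n) hz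
    apply ContinuousAt.continuousWithinAt
    rw [ContinuousAt, tendsto_iff_dist_tendsto_zero]
    have bound_cont : Continuous fun p : ℂ × StoneCech ℕ =>
        2 * M / r * dist p.1 w + dist (G w p.2) (G w ξ₀) := by
      have := (hG w hw).1
      fun_prop
    refine squeeze_zero' (Filter.Eventually.of_forall fun _ => dist_nonneg) ?_
      (by simpa using bound_cont.tendsto (w, ξ₀))
    filter_upwards [continuousAt_fst (Metric.ball_mem_nhds w hr)] with p hp
    exact (dist_triangle _ (G w p.2) _).trans (by gcongr; exact lip p.1 hp p.2)
  · exact denseRange_stoneCechUnit.induction_on ξ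
      (isClosed_le (hG z hz).1.norm continuous_const) fun n => by
        simpa only [(hG z hz).2] using h z hz n
  · have hslice : Continuous fun ξ => F' (z, ξ) :=
      hF'.comp_continuous (by fun_prop) fun ξ => ⟨hz, Set.mem_univ ξ⟩
    exact congrFun (denseRange_stoneCechUnit.equalizer hslice (hG z hz).1
      (funext fun n => (hF'f z hz n).trans ((hG z hz).2 n).symm)) ξ
end
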